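/- Let (X,H,ν) be a categorical augmented rack and let q : X⊗X → X be the associated SD map, q(x⊗y) = x·ν(y). Then q is categorically self-distributive: for all x,y,z ∈ X, q(q(x⊗y)⊗z) = q( q(x⊗z⁽¹⁾) ⊗ q(y⊗z⁽²⁾) ); equivalently, as linear maps X⊗X⊗X → X, q∘(q⊗1) = q∘(q⊗q)∘(1⊗τ⊗1)∘(1⊗1⊗Δ_X), where τ is the transposition of tensor factors. -/

import Mathlib

open TensorProduct

/-- `sandwich a` is the linear map `H ⊗ H → H` sending `g⁽¹⁾ ⊗ g⁽²⁾` to `S(g⁽¹⁾) * a * g⁽²⁾`. -/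
noncomputable def sandwich {k : Type*} [CommRing k] {H : Type*} [Ring H] [HopfAlgebra k H]
    (a : H) : H ⊗[k] H →ₗ[k] H :=
  LinearMap.mul' k H ∘ₗ
    LinearMap.rTensor H (LinearMap.mulRight k a ∘ₗ HopfAlgebra.antipode (R := k))

/-- In a Hopf algebra, `g⁽¹⁾ S(g⁽²⁾) a g⁽³⁾ = a g`. -/
theorem mul'_lTensor_sandwich_comul {k : Type*} [CommRing k] {H : Type*} [Ring H]
    [HopfAlgebra k H] (a g : H) :
    LinearMap.mul' k H (LinearMap.lTensor H (sandwich a ∘ₗ Coalgebra.comul (R := k))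
      (Coalgebra.comul (R := k) g)) = a * g := by
  have sandwich_assoc : LinearMap.mul' k H ∘ₗ LinearMap.lTensor H (sandwich a) ∘ₗ
      (TensorProduct.assoc k H H H).toLinearMap =
      LinearMap.mul' k H ∘ₗ TensorProduct.map
        (LinearMap.mul' k H ∘ₗ LinearMap.lTensor H (HopfAlgebra.antipode k))
        (LinearMap.mulLeft k a) := by
    ext p q r
    simp [sandwich, mul_assoc]
  have counit_mul : LinearMap.mul' k H ∘ₗ TensorProduct.map
      (Algebra.linearMap k H) (LinearMap.mulLeft k a) =
      LinearMap.mulLeft k a ∘ₗ (TensorProduct.lid k H).toLinearMap := by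
    ext r
    simp
  calc
    _ = (LinearMap.mul' k H ∘ₗ LinearMap.lTensor H (sandwich a) ∘ₗ
          (TensorProduct.assoc k H H H).toLinearMap)
          (LinearMap.rTensor H Coalgebra.comul (Coalgebra.comul (R := k) g)) := by
      simp [LinearMap.lTensor_comp]
    _ = (LinearMap.mul' k H ∘ₗ TensorProduct.map
          (Algebra.linearMap k H) (LinearMap.mulLeft k a))
          (LinearMap.rTensor H Coalgebra.counit (Coalgebra.comul (R := k) g)) := by
      rw [sandwich_assoc]
      rw [LinearMap.comp_apply, LinearMap.comp_apply, ← LinearMap.comp_apply (TensorProduct.map _ _),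
        ← LinearMap.comp_apply (TensorProduct.map _ _), LinearMap.map_comp_rTensor,
        LinearMap.map_comp_rTensor, LinearMap.comp_assoc, HopfAlgebra.mul_antipode_lTensor_comul]
    _ = a * g := by
      rw [counit_mul]
      simp

/-- the map `q(x ⊗ y) = x · ν(y)` associated with a categorical augmented rack
`(X, H, ν)` is categorically self-distributive:
`q(q(x⊗y)⊗z) = q(q(x⊗z⁽¹⁾) ⊗ q(y⊗z⁽²⁾))`. -/
theorem categoricalAugmentedRack_self_distributive
    {k : Type*} [CommRing k] {H : Type*} [Ring H] [HopfAlgebra k H]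
    {X : Type*} [AddCommGroup X] [Module k X] [Coalgebra k X]
    -- the right `H`-module action on `X`
    (act : X ⊗[k] H →ₗ[k] X)
    (hact_one : ∀ x : X, act (x ⊗ₜ (1 : H)) = x)
    (hact_mul : ∀ (x : X) (g h : H), act (act (x ⊗ₜ g) ⊗ₜ h) = act (x ⊗ₜ (g * h)))
    -- compatibility of the action with the comultiplications:
    -- `Δ_X(x·g) = (x⁽¹⁾·g⁽¹⁾) ⊗ (x⁽²⁾·g⁽²⁾)` and `ε_X(x·g) = ε_X(x) ε_H(g)`
    (hcompat : (Coalgebra.comul (R := k) (A := X)) ∘ₗ act =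
      TensorProduct.map act act ∘ₗ (TensorProduct.tensorTensorTensorComm k X X H H).toLinearMap
        ∘ₗ TensorProduct.map (Coalgebra.comul (R := k)) (Coalgebra.comul (R := k)))
    (hcounit : ∀ (x : X) (g : H),
      Coalgebra.counit (R := k) (act (x ⊗ₜ g)) =
        Coalgebra.counit (R := k) x * Coalgebra.counit (R := k) g)
    -- the augmentation map `ν : X → H`, a coalgebra morphism with
    -- `ν(x·g) = S(g⁽¹⁾) ν(x) g⁽²⁾`
    (ν : X →ₗ[k] H)
    (hν_comul : (Coalgebra.comul (R := k) (A := H)) ∘ₗ ν =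
      TensorProduct.map ν ν ∘ₗ Coalgebra.comul (R := k))
    (hν_counit : (Coalgebra.counit (R := k) (A := H)) ∘ₗ ν = Coalgebra.counit (R := k))
    (hν_aug : ∀ (x : X) (g : H), ν (act (x ⊗ₜ g)) = sandwich (ν x) (Coalgebra.comul (R := k) g))
    -- the associated SD map `q(x ⊗ y) = x · ν(y)`
    (q : X ⊗[k] X →ₗ[k] X)
    (hq : ∀ x y : X, q (x ⊗ₜ y) = act (x ⊗ₜ ν y)) :
    ∀ x y z : X,
      q (q (x ⊗ₜ y) ⊗ₜ z) =
        q (TensorProduct.map q q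
          ((TensorProduct.tensorTensorTensorComm k X X X X)
            ((x ⊗ₜ y) ⊗ₜ Coalgebra.comul (R := k) z))) := by
  intro x y z
  have comul_ν : Coalgebra.comul (R := k) (ν z) =
      TensorProduct.map ν ν (Coalgebra.comul (R := k) z) := LinearMap.congr_fun hν_comul z
  have q_tensor (t : X ⊗[k] X) :
      q (TensorProduct.map q q
        ((TensorProduct.tensorTensorTensorComm k X X X X) ((x ⊗ₜ y) ⊗ₜ t))) =
      act (x ⊗ₜ LinearMap.mul' k H (LinearMap.lTensor H
        (sandwich (ν y) ∘ₗ Coalgebra.comul (R := k)) (TensorProduct.map ν ν t))) := by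
    induction t with
    | zero => simp
    | add s t hs ht => simp only [TensorProduct.tmul_add, map_add, hs, ht]
    | tmul u v => simp [hq, hact_mul, hν_aug]
  rw [q_tensor, ← comul_ν, mul'_lTensor_sandwich_comul, hq, hq, hact_mul]
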